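/- arXiv:1709.01196 — 5 statements merged into one kernel-verified Lean document; each statement's English description precedes it below -/
import Mathlib

section
/- Let Q be a locally compact Hausdorff space and let c : Q × Q → M(Q) assign to each pair (s,t) a compactly supported Radon probability measure c(s,t) on Q, such that (s,t) ↦ (Δ̃f)(s,t) := ∫_Q f dc(s,t) is continuous for every bounded continuous f : Q → ℂ, and such that for every open W ⊆ Q the set {(s,t) : supp c(s,t) ⊆ W} is open. Let ˇ : Q → Q be a homeomorphism with ˇ∘ˇ = id, and let e ∈ Q be such that for all s,t ∈ Q: e ∈ supp c(s,t) if and only if t = š. Then the graph Γˇ = {(p, p̌) : p ∈ Q} satisfies Γˇ = ⋂_f supp(Δ̃f), where the intersection is over all compactly supported continuous f : Q → ℝ with f ≥ 0 and f(e) > 0, and supp(Δ̃f) denotes the closure of {(s,t) : (Δ̃f)(s,t) ≠ 0}. -/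
open MeasureTheory Topology BoundedContinuousFunction

/-- The support of a nonnegative Borel measure: the set of points all of whose open
neighbourhoods have positive measure. -/
def measureSupport {Q : Type*} [TopologicalSpace Q] [MeasurableSpace Q]
    (μ : Measure Q) : Set Q :=
  {x | ∀ U : Set Q, IsOpen U → x ∈ U → 0 < μ U}

theorem isClosed_measureSupport {Q : Type*} [TopologicalSpace Q] [MeasurableSpace Q]
    (μ : Measure Q) : IsClosed (measureSupport μ) := by
  rw [← isOpen_compl_iff, isOpen_iff_forall_mem_open]
  intro x hx
  simp only [measureSupport, Set.mem_compl_iff, Set.mem_ofPred_eq, not_forall] at hx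
  obtain ⟨U, hU, hxU, hμU⟩ := hx
  exact ⟨U, fun y hyU hy => hμU (hy U hU hyU), hU, hxU⟩

theorem measure_eq_zero_of_isCompact_of_measureSupport_subset_compl {Q : Type*}
    [TopologicalSpace Q] [MeasurableSpace Q] {μ : Measure Q} {K : Set Q} (hK : IsCompact K)
    (h : measureSupport μ ⊆ Kᶜ) : μ K = 0 := by
  refine hK.measure_zero_of_nhdsWithin fun x hx => ?_
  have hxs : x ∉ measureSupport μ := fun hx' => h hx' hx
  simp only [measureSupport, Set.mem_ofPred_eq, not_forall] at hxs
  obtain ⟨U, hU, hxU, hμU⟩ := hxs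
  exact ⟨U, mem_nhdsWithin_of_mem_nhds (hU.mem_nhds hxU), by simpa using hμU⟩

theorem integral_pos_of_mem_measureSupport {Q : Type*} [TopologicalSpace Q] [MeasurableSpace Q]
    {μ : Measure Q} {f : Q → ℝ} (hf : Continuous f) (hint : Integrable f μ)
    (hf0 : ∀ x, 0 ≤ f x) {e : Q} (hfe : 0 < f e) (he : e ∈ measureSupport μ) :
    0 < ∫ x, f x ∂μ := by
  rw [integral_pos_iff_support_of_nonneg hf0 hint]
  exact he _ hf.isOpen_support hfe.ne'

/-- Property (H̃7): the graph of the involution coincides with the intersection of the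
supports of `Δ̃f` over all compactly supported continuous `f ≥ 0` with `f(e) > 0`. -/
theorem stmt5 {Q : Type*} [TopologicalSpace Q] [LocallyCompactSpace Q] [T2Space Q]
    [MeasurableSpace Q] [BorelSpace Q]
    (c : Q × Q → Measure Q)
    (hprob : ∀ st, IsProbabilityMeasure (c st))
    (hreg : ∀ st, (c st).InnerRegular)
    (hcsupp : ∀ st, IsCompact (measureSupport (c st)))
    (hcont : ∀ f : Q →ᵇ ℂ, Continuous fun st => ∫ x, f x ∂(c st))
    (husc : ∀ W : Set Q, IsOpen W → IsOpen {st | measureSupport (c st) ⊆ W})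
    (inv : Q ≃ₜ Q) (hinv : ∀ p, inv (inv p) = p) (e : Q)
    (he : ∀ s t : Q, e ∈ measureSupport (c (s, t)) ↔ t = inv s) :
    {st : Q × Q | st.2 = inv st.1} =
      ⋂ f ∈ {f : Q → ℝ | Continuous f ∧ HasCompactSupport f ∧ (∀ x, 0 ≤ f x) ∧ 0 < f e},
        closure {st : Q × Q | ∫ x, f x ∂(c st) ≠ 0} := by
  ext ⟨s, t⟩
  simp only [Set.mem_ofPred_eq, Set.mem_iInter]
  constructor
  · rintro hst f ⟨hf, hfc, hf0, hfe⟩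
    have := hprob (s, t)
    exact subset_closure (integral_pos_of_mem_measureSupport hf
      (hf.integrable_of_hasCompactSupport hfc) hf0 hfe ((he s t).2 hst)).ne'
  · intro h
    rw [← he]
    by_contra hes
    obtain ⟨K, hK, heK, hKs⟩ := exists_compact_subset
      (isClosed_measureSupport (c (s, t))).isOpen_compl hes
    obtain ⟨f, hf1, hf0, hfc, hf01⟩ := exists_continuous_one_zero_of_isCompact
      (isCompact_singleton (x := e)) isOpen_interior.isClosed_compl
      (Set.disjoint_singleton_left.2 fun h => h heK)
    have hfe : f e = 1 := hf1 rfl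
    have hmem := h f ⟨f.continuous, hfc, fun x => (hf01 x).1, by simp [hfe]⟩
    obtain ⟨p, hpK, hp⟩ := mem_closure_iff.1 hmem _ (husc Kᶜ hK.isClosed.isOpen_compl)
      (Set.subset_compl_comm.1 hKs)
    refine hp (integral_eq_zero_of_ae ?_)
    have hnull : ∀ᵐ x ∂(c p), x ∉ K :=
      measure_eq_zero_iff_ae_notMem.1
        (measure_eq_zero_of_isCompact_of_measureSupport_subset_compl hK hpK)
    filter_upwards [hnull] with x hx
    exact hf0 fun hx' => hx (interior_subset hx')
end

section
/- Let Q be a locally compact Hausdorff space and let c : Q × Q → M(Q) assign to each pair (s,t) a compactly supported Radon probability measure c(s,t) on Q such that (s,t) ↦ ∫_Q f dc(s,t) is continuous for every bounded continuous f. Assume the following property: for every closed F ⊆ Q, every (s₀,t₀) ∈ Q × Q, and every compactly supported continuous f₀ with 0 ≤ f₀ ≤ 1, f₀ ≡ 0 on F and ∫ f₀ dc(s₀,t₀) = 1, there exist an open neighbourhood U of (s₀,t₀) and a bounded continuous f with 0 ≤ f ≤ 1, f ≡ 0 on F and ∫ f dc(s,t) = 1 for all (s,t) ∈ U. Then the supports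 are upper semicontinuous: for every (s₀,t₀) and every open W ⊇ supp c(s₀,t₀), there exists an open neighbourhood U of (s₀,t₀) such that supp c(s,t) ⊆ W for all (s,t) ∈ U. -/
open MeasureTheory Topology BoundedContinuousFunction

theorem measureSupport_eq_support {Q : Type*} [TopologicalSpace Q] [MeasurableSpace Q]
    (μ : Measure Q) : measureSupport μ = μ.support := by
  ext x
  rw [Measure.mem_support_iff_forall]
  constructor
  · intro h U hU
    obtain ⟨V, hVU, hV, hxV⟩ := mem_nhds_iff.mp hU
    exact (h V hV hxV).trans_le (measure_mono hVU)
  · intro h U hU hxU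
    exact h U (hU.mem_nhds hxU)

/-- A bounded continuous function with values at most `1` whose integral against a probability
measure is `1` equals `1` on the support of that measure. -/
theorem eq_one_of_mem_measureSupport_of_integral_eq_one {Q : Type*} [TopologicalSpace Q]
    [MeasurableSpace Q] [OpensMeasurableSpace Q] (μ : Measure Q) [IsProbabilityMeasure μ]
    (f : Q →ᵇ ℝ) (hf : ∀ x, f x ≤ 1) (hint : ∫ x, f x ∂μ = 1)
    {x : Q} (hx : x ∈ measureSupport μ) : f x = 1 := by
  by_contra hne
  have hzero : ∫ y, (1 - f y) ∂μ = 0 := by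
    rw [integral_sub (integrable_const _) (f.integrable μ), hint]
    simp
  have hae : (fun y => 1 - f y) =ᵐ[μ] 0 :=
    (integral_eq_zero_iff_of_nonneg (fun y => sub_nonneg.mpr (hf y))
      ((integrable_const _).sub (f.integrable μ))).mp hzero
  have hpos := hx {y | f y < 1} (isOpen_lt f.continuous continuous_const)
    (lt_of_le_of_ne (hf x) hne)
  refine hpos.ne' (measure_mono_null (fun y hy => ?_) (ae_iff.mp hae))
  exact (sub_pos.mpr hy).ne'

/-- Upper semicontinuity of supports follows from property (H̃4). -/
theorem stmt7 {Q : Type*} [TopologicalSpace Q] [LocallyCompactSpace Q] [T2Space Q]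
    [MeasurableSpace Q] [BorelSpace Q]
    (c : Q × Q → Measure Q)
    (hprob : ∀ st, IsProbabilityMeasure (c st))
    (hreg : ∀ st, (c st).InnerRegular)
    (hcsupp : ∀ st, IsCompact (measureSupport (c st)))
    (hcont : ∀ f : Q →ᵇ ℂ, Continuous fun st => ∫ x, f x ∂(c st))
    (hH4 : ∀ F : Set Q, IsClosed F → ∀ s₀ t₀ : Q, ∀ f₀ : Q → ℝ,
      Continuous f₀ → HasCompactSupport f₀ → (∀ x, 0 ≤ f₀ x) → (∀ x, f₀ x ≤ 1) →
      (∀ r ∈ F, f₀ r = 0) → ∫ x, f₀ x ∂(c (s₀, t₀)) = 1 →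
      ∃ U : Set (Q × Q), IsOpen U ∧ (s₀, t₀) ∈ U ∧
        ∃ f : Q →ᵇ ℝ, (∀ x, 0 ≤ f x) ∧ (∀ x, f x ≤ 1) ∧ (∀ r ∈ F, f r = 0) ∧
          ∀ st ∈ U, ∫ x, f x ∂(c st) = 1) :
    ∀ s₀ t₀ : Q, ∀ W : Set Q, IsOpen W → measureSupport (c (s₀, t₀)) ⊆ W →
      ∃ U : Set (Q × Q), IsOpen U ∧ (s₀, t₀) ∈ U ∧
        ∀ st ∈ U, measureSupport (c st) ⊆ W := by
  intro s₀ t₀ W hW hsub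
  have := hprob
  have := hreg (s₀, t₀)
  obtain ⟨f₀, hone, hzero, hcomp, hmem⟩ := exists_continuous_one_zero_of_isCompact
    (hcsupp (s₀, t₀)) hW.isClosed_compl (Set.disjoint_compl_right_iff_subset.mpr hsub)
  have hint : ∫ x, f₀ x ∂(c (s₀, t₀)) = 1 := by
    have hae : ∀ᵐ x ∂(c (s₀, t₀)), f₀ x = 1 := by
      filter_upwards [Measure.support_mem_ae_of_innerRegular (μ := c (s₀, t₀))] with x hx
      exact hone (by rwa [measureSupport_eq_support])
    simp [integral_congr_ae hae]
  obtain ⟨U, hU, hmemU, f, -, hle, hf, hfint⟩ := hH4 Wᶜ hW.isClosed_compl s₀ t₀ f₀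
    f₀.continuous hcomp (fun x => (hmem x).1) (fun x => (hmem x).2) (fun r hr => hzero hr) hint
  refine ⟨U, hU, hmemU, fun st hst x hx => ?_⟩
  by_contra hxW
  have h := eq_one_of_mem_measureSupport_of_integral_eq_one (c st) f hle (hfint st hst) hx
  rw [hf x hxW] at h
  exact zero_ne_one h
end

section
/- Let Q be a locally compact Hausdorff space, c : Q × Q → M(Q) a map assigning to each (s,t) a compactly supported Radon probability measure c(s,t) such that (Δ̃f)(s,t) := ∫_Q f dc(s,t) is continuous in (s,t) for every bounded continuous f. Let ˇ : Q → Q be a homeomorphism with ˇ∘ˇ = id and let e ∈ Q. Assume the graph inclusion ⋂_f supp(Δ̃f) ⊆ {(p, p̌) : p ∈ Q}, where the intersection is over all compactly supported continuous f ≥ 0 with f(e) > 0 and supp(Δ̃f) is the closure of {(s,t) : (Δ̃f)(s,t) ≠ 0}. Then for all s, t ∈ Q: if e ∈ supp c(s,t), then t = š. -/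
open MeasureTheory Topology BoundedContinuousFunction

/-- From the graph inclusion (H̃7) one deduces hypergroup axiom (H7): if
`e ∈ supp c(s,t)` then `t = š`. -/
theorem stmt8 {Q : Type*} [TopologicalSpace Q] [LocallyCompactSpace Q] [T2Space Q]
    [MeasurableSpace Q] [BorelSpace Q]
    (c : Q × Q → Measure Q)
    (hprob : ∀ st, IsProbabilityMeasure (c st))
    (hreg : ∀ st, (c st).InnerRegular)
    (hcsupp : ∀ st, IsCompact (measureSupport (c st)))
    (hcont : ∀ f : Q →ᵇ ℂ, Continuous fun st => ∫ x, f x ∂(c st))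
    (inv : Q ≃ₜ Q) (hinv : ∀ p, inv (inv p) = p) (e : Q)
    (hgraph :
      (⋂ f ∈ {f : Q → ℝ | Continuous f ∧ HasCompactSupport f ∧ (∀ x, 0 ≤ f x) ∧ 0 < f e},
        closure {st : Q × Q | ∫ x, f x ∂(c st) ≠ 0}) ⊆ {st : Q × Q | st.2 = inv st.1}) :
    ∀ s t : Q, e ∈ measureSupport (c (s, t)) → t = inv s := by
  intro s t he
  refine hgraph (a := (s, t)) ?_
  simp only [Set.mem_iInter]
  rintro f ⟨hf, hfc, hf0, hfe⟩
  have := hprob (s, t)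
  exact subset_closure <| ne_of_gt <|
    (integral_pos_iff_support_of_nonneg hf0 (hf.integrable_of_hasCompactSupport hfc)).2 <|
      he _ hf.isOpen_support hfe.ne'
end

section
/- Let G be a locally compact Hausdorff space, Q a Hausdorff space, φ : G → Q a continuous map, and P a positive linear map on continuous complex-valued functions on G such that: (a) P maps nonnegative compactly supported continuous functions to nonnegative compactly supported continuous functions; (b) each Pf is constant on the fibres of φ, i.e. (Pf)(p) = (Pf)(q) whenever φ(p) = φ(q); and (c) for every nonnegative compactly supported continuous f and every p ∈ G, f(p) > 0 implies (Pf)(p) > 0. Then for every s ∈ Q, the fibre O_s = φ⁻¹({s}) is compact. -/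
open MeasureTheory Topology

/-- Proposition 3 (iii): under the stated conditions on the positive map `P` and the
continuous map `φ`, every fibre `O_s = φ⁻¹({s})` is compact. -/
theorem stmt9 {G Q : Type*} [TopologicalSpace G] [LocallyCompactSpace G] [T2Space G]
    [TopologicalSpace Q] [T2Space Q]
    (φ : G → Q) (hφ : Continuous φ)
    (P : C(G, ℂ) →ₗ[ℂ] C(G, ℂ))
    (hpos : ∀ f : C(G, ℂ), (∀ x, (f x).im = 0 ∧ 0 ≤ (f x).re) →
      ∀ x, ((P f) x).im = 0 ∧ 0 ≤ ((P f) x).re)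
    (ha : ∀ f : C(G, ℂ), HasCompactSupport ⇑f → (∀ x, (f x).im = 0 ∧ 0 ≤ (f x).re) →
      HasCompactSupport ⇑(P f))
    (hb : ∀ f : C(G, ℂ), ∀ p q : G, φ p = φ q → (P f) p = (P f) q)
    (hc : ∀ f : C(G, ℂ), HasCompactSupport ⇑f → (∀ x, (f x).im = 0 ∧ 0 ≤ (f x).re) →
      ∀ p : G, 0 < (f p).re → 0 < ((P f) p).re) :
    ∀ s : Q, IsCompact (φ ⁻¹' {s}) := by
  intro s
  rcases (φ ⁻¹' {s}).eq_empty_or_nonempty with hs | ⟨p, hp⟩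
  · rw [hs]
    exact isCompact_empty
  obtain ⟨g, hg1, -, hgc, hg01⟩ := exists_continuous_one_zero_of_isCompact
    (isCompact_singleton (x := p)) isClosed_empty (Set.disjoint_empty _)
  let f : C(G, ℂ) := ⟨fun x => (g x : ℂ), by fun_prop⟩
  have hf_supp : HasCompactSupport ⇑f := hgc.comp_left (g := fun r : ℝ => (r : ℂ)) (by simp)
  have hf_nonneg : ∀ x, (f x).im = 0 ∧ 0 ≤ (f x).re := fun x => by
    simpa [f] using (hg01 x).1
  have hf_pos : 0 < (f p).re := by
    have h : g p = 1 := hg1 (Set.mem_singleton p)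
    simp [f, h]
  have hPf := hc f hf_supp hf_nonneg p hf_pos
  refine (ha f hf_supp hf_nonneg).isCompact.of_isClosed_subset
    (isClosed_singleton.preimage hφ) fun q hq => subset_tsupport _ ?_
  have hq' : φ p = φ q := Eq.trans hp (Eq.symm hq)
  rw [Function.mem_support, ← hb f p q hq']
  intro h
  simp [h] at hPf
end

section
/- Let G and Q be locally compact Hausdorff spaces, φ : G → Q a continuous map, and P : C_b(G) → C_b(G) a linear map on bounded continuous complex-valued functions satisfying the module property P((g̃∘φ)·f) = (g̃∘φ)·P(f) for every bounded continuous g̃ : Q → ℂ and every f ∈ C_b(G). Then for every p₀ ∈ G and every compactly supported continuous f : G → ℂ whose support is disjoint from the fibre φ⁻¹({φ(p₀)}), one has (Pf)(p₀) = 0. -/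
open MeasureTheory Topology BoundedContinuousFunction

/-- If `P : C_b(G) → C_b(G)` is linear and a module map over pullbacks along `φ`, then
`(Pf)(p₀) = 0` whenever `f` is compactly supported and `supp(f)` is disjoint from the
fibre of `φ` through `p₀`. -/
theorem stmt10 {G Q : Type*} [TopologicalSpace G] [LocallyCompactSpace G] [T2Space G]
    [TopologicalSpace Q] [LocallyCompactSpace Q] [T2Space Q]
    (φ : C(G, Q))
    (P : (G →ᵇ ℂ) →ₗ[ℂ] (G →ᵇ ℂ))
    (hmod : ∀ (g : Q →ᵇ ℂ) (f : G →ᵇ ℂ),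
      P (g.compContinuous φ * f) = g.compContinuous φ * P f)
    (p₀ : G) (f : G →ᵇ ℂ) (hf : HasCompactSupport ⇑f)
    (hdisj : Disjoint (tsupport ⇑f) (φ ⁻¹' {φ p₀})) :
    (P f) p₀ = 0 := by
  have hd : Disjoint (φ '' tsupport ⇑f) {φ p₀} := Set.disjoint_image_left.mpr hdisj
  obtain ⟨h, h_zero, h_one, h_mem⟩ := exists_continuous_zero_one_of_isCompact'
    (hf.isCompact.image φ.continuous) isClosed_singleton hd
  let g : Q →ᵇ ℂ := BoundedContinuousFunction.ofNormedAddCommGroup (fun q ↦ (h q : ℂ))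
    (by fun_prop) 1 fun q ↦ by
      rw [Complex.norm_real, Real.norm_of_nonneg (h_mem q).1]
      exact (h_mem q).2
  have g_mul : g.compContinuous φ * f = f := by
    ext x
    change (h (φ x) : ℂ) * f x = f x
    by_cases hx : x ∈ tsupport ⇑f
    · simp [h_one (Set.mem_image_of_mem φ hx)]
    · simp [image_eq_zero_of_notMem_tsupport hx]
  rw [← g_mul, hmod]
  change (h (φ p₀) : ℂ) * P f p₀ = 0
  simp [h_zero (Set.mem_singleton (φ p₀))]
end
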